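/- (Single-element history extension preserves compliance.) If ⟨δ⃗⟩ρ ⫤ ⟨γ⃗⟩σ, then for every ρ' ∈ RC ∪ {∘} we have ⟨ρ' : δ⃗⟩ρ ⫤ ⟨γ⃗⟩σ (pushing ρ' at the bottom of the client's history), and likewise for every σ' ∈ RC ∪ {∘} we have ⟨δ⃗⟩ρ ⫤ ⟨σ' : γ⃗⟩σ (pushing σ' at the bottom of the server's history). -/

import Mathlib

/-! Retractable contracts (Barbanera, Dezani-Ciancaglini, Lanese, de'Liguoro,
"Retractable Contracts"). -/

/-- Retractable contract expressions, with de Bruijn indices for recursion.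
`ext true l` is a retractable input sum `Σ aᵢ.σᵢ`, `ext false l` a retractable
output sum `Σ āᵢ.σᵢ`, and `intSum l` an unretractable output choice `⊕ āᵢ.σᵢ`. -/
inductive RC : Type
  | one : RC
  | ext : Bool → List (ℕ × RC) → RC
  | intSum : List (ℕ × RC) → RC
  | var : ℕ → RC
  | mu : RC → RC

namespace RC

/-- Substitution of the (closed) term `u` for variable `k`. -/
def subst (t : RC) (k : ℕ) (u : RC) : RC :=
  match t with
  | .one => .one
  | .var n => if n = k then u else .var n
  | .mu σ => .mu (subst σ (k+1) u)
  | .ext p l => .ext p (l.attach.map fun x => (x.1.1, subst x.1.2 k u))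
  | .intSum l => .intSum (l.attach.map fun x => (x.1.1, subst x.1.2 k u))
termination_by sizeOf t
decreasing_by
  all_goals simp_wf
  all_goals first
    | omega
    | (obtain ⟨⟨a, s⟩, hx⟩ := x
       have h := List.sizeOf_lt_of_mem hx
       simp [Prod.mk.sizeOf_spec] at h ⊢
       omega)

/-- One-step unfolding of the recursive contract `mu σ`
(`rec x.σ` is equated with `σ[rec x.σ / x]`). -/
def unf (σ : RC) : RC := subst σ 0 (.mu σ)

/-- Well-formedness: `WFa n σ` means all free variables of `σ` are below `n`,
all sums are non-empty with pairwise distinct names, and recursion is guarded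
(the body of a recursion is not a variable). -/
inductive WFa : ℕ → RC → Prop
  | one : ∀ n, WFa n .one
  | var : ∀ n m, m < n → WFa n (.var m)
  | ext : ∀ (n : ℕ) (p : Bool) (l : List (ℕ × RC)), l ≠ [] → (l.map Prod.fst).Nodup →
      (∀ x ∈ l, WFa n x.2) → WFa n (.ext p l)
  | intSum : ∀ (n : ℕ) (l : List (ℕ × RC)), l ≠ [] → (l.map Prod.fst).Nodup →
      (∀ x ∈ l, WFa n x.2) → WFa n (.intSum l)
  | mu : ∀ (n : ℕ) (σ : RC), (∀ m, σ ≠ .var m) → WFa (n+1) σ → WFa n (.mu σ)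

end RC

/-- A retractable contract: a closed well-formed expression. -/
def WF (σ : RC) : Prop := RC.WFa 0 σ

/-- Head unfolding: `Unf ρ τ` holds when repeatedly unfolding top-level
recursion in `ρ` yields `τ` (equi-recursive view of recursion). -/
inductive Unf : RC → RC → Prop
  | one : Unf .one .one
  | ext : ∀ p l, Unf (.ext p l) (.ext p l)
  | intSum : ∀ l, Unf (.intSum l) (.intSum l)
  | var : ∀ n, Unf (.var n) (.var n)
  | mu : ∀ σ τ, Unf (RC.unf σ) τ → Unf (.mu σ) τ

/-- Actions of the LTS: `act true a` is the input `a`, `act false a` is the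
output `ā`; `tau` is the internal action; `rb` is rollback. -/
inductive Act : Type
  | act : Bool → ℕ → Act
  | tau : Act
  | rb : Act

/-- Histories (stacks); the head of the list is the top of the stack.
`none` is the placeholder `∘` (no remaining alternatives). -/
abbrev Hist := List (Option RC)

/-- The sum of the remaining branches of a retractable sum, or `∘` if no
branch remains. -/
def restOf (p : Bool) (l : List (ℕ × RC)) : Option RC :=
  match l with
  | [] => none
  | _ => some (.ext p l)

/-- LTS of contracts with histories: rules (+)/(α) (`ext`, `intOut`), (⊕)
(`intTau`), (rb) (`rb`), plus transparent unfolding of recursion (`mu`). -/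
inductive Step : Hist → Option RC → Act → Hist → Option RC → Prop
  | ext : ∀ (γ : Hist) (p : Bool) (l₁ l₂ : List (ℕ × RC)) (a : ℕ) (σ : RC),
      Step γ (some (.ext p (l₁ ++ (a, σ) :: l₂))) (.act p a)
        (restOf p (l₁ ++ l₂) :: γ) (some σ)
  | intTau : ∀ (γ : Hist) (l : List (ℕ × RC)) (a : ℕ) (σ : RC),
      (a, σ) ∈ l → 2 ≤ l.length →
      Step γ (some (.intSum l)) .tau γ (some (.intSum [(a, σ)]))
  | intOut : ∀ (γ : Hist) (a : ℕ) (σ : RC),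
      Step γ (some (.intSum [(a, σ)])) (.act false a) (none :: γ) (some σ)
  | rb : ∀ (γ : Hist) (σ' ρ : Option RC),
      Step (σ' :: γ) ρ .rb γ σ'
  | mu : ∀ (γ : Hist) (σ : RC) (α : Act) (δ : Hist) (ρ : Option RC),
      Step γ (some (RC.unf σ)) α δ ρ → Step γ (some (.mu σ)) α δ ρ

/-- Client/server configurations `⟨cH⟩c ∥ ⟨sH⟩s`. -/
structure Conf : Type where
  cH : Hist
  c  : Option RC
  sH : Hist
  s  : Option RC

/-- Forward reduction of client/server pairs: rules (comm) and (τ). -/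
inductive FRed : Conf → Conf → Prop
  | comm : ∀ (δ δ' γ γ' : Hist) (ρ ρ' σ σ' : Option RC) (p : Bool) (a : ℕ),
      Step δ ρ (.act p a) δ' ρ' → Step γ σ (.act (!p) a) γ' σ' →
      FRed ⟨δ, ρ, γ, σ⟩ ⟨δ', ρ', γ', σ'⟩
  | tauL : ∀ (δ δ' γ : Hist) (ρ ρ' σ : Option RC),
      Step δ ρ .tau δ' ρ' → FRed ⟨δ, ρ, γ, σ⟩ ⟨δ', ρ', γ, σ⟩
  | tauR : ∀ (δ γ γ' : Hist) (ρ σ σ' : Option RC),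
      Step γ σ .tau γ' σ' → FRed ⟨δ, ρ, γ, σ⟩ ⟨δ, ρ, γ', σ'⟩

/-- Reduction of client/server pairs: forward steps, plus the rule (rbk),
applicable only when the client is not `1` and no forward step is possible. -/
inductive Red : Conf → Conf → Prop
  | fwd : ∀ c c', FRed c c' → Red c c'
  | rbk : ∀ (δ δ' γ γ' : Hist) (ρ ρ' σ σ' : Option RC),
      ρ ≠ some .one → (∀ d, ¬ FRed ⟨δ, ρ, γ, σ⟩ d) →
      Step δ ρ .rb δ' ρ' → Step γ σ .rb γ' σ' →
      Red ⟨δ, ρ, γ, σ⟩ ⟨δ', ρ', γ', σ'⟩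

/-- Multi-step reduction of client/server pairs. -/
def Reds : Conf → Conf → Prop := Relation.ReflTransGen Red

/-- A configuration admitting no reduction. -/
def Stuck (c : Conf) : Prop := ∀ c', ¬ Red c c'

/-- A rollback step of a client/server pair (an instance of rule (rbk)). -/
def RbkStep (c c' : Conf) : Prop :=
  c.c ≠ some RC.one ∧ (∀ d, ¬ FRed c d) ∧
  Step c.cH c.c .rb c'.cH c'.c ∧ Step c.sH c.s .rb c'.sH c'.s

/-- Compliance of contracts with histories: every reachable stuck
configuration has client `1`. -/
def CompliantCH (δ : Hist) (ρ : Option RC) (γ : Hist) (σ : Option RC) : Prop :=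
  ∀ c' : Conf, Reds ⟨δ, ρ, γ, σ⟩ c' → Stuck c' → c'.c = some RC.one

/-- Compliance of contracts: `ρ ⫤ σ`. -/
def Compliant (ρ σ : RC) : Prop := CompliantCH [] (some ρ) [] (some σ)

/-- The formal system for compliance: `Derives Γ ρ σ` is the judgment
`Γ ▷ ρ ⊣ σ`, with rules (Ax), (Hyp), (+,+), (⊕,+), (+,⊕), and rules
realising the equi-recursive identification `rec x.σ = σ[rec x.σ/x]`. -/
inductive Derives : List (RC × RC) → RC → RC → Prop
  | ax : ∀ Γ σ, Derives Γ .one σ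
  | hyp : ∀ Γ ρ σ, (ρ, σ) ∈ Γ → Derives Γ ρ σ
  | plusPlus : ∀ (Γ : List (RC × RC)) (p : Bool) (lρ lσ : List (ℕ × RC)) (a : ℕ) (ρk σk : RC),
      (a, ρk) ∈ lρ → (a, σk) ∈ lσ →
      Derives ((RC.ext p lρ, RC.ext (!p) lσ) :: Γ) ρk σk →
      Derives Γ (.ext p lρ) (.ext (!p) lσ)
  | oplusPlus : ∀ (Γ : List (RC × RC)) (lρ lσ : List (ℕ × RC)),
      (∀ x ∈ lρ, x.1 ∈ lσ.map Prod.fst) →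
      (∀ (a : ℕ) (ρi σi : RC), (a, ρi) ∈ lρ → (a, σi) ∈ lσ →
        Derives ((RC.intSum lρ, RC.ext true lσ) :: Γ) ρi σi) →
      Derives Γ (.intSum lρ) (.ext true lσ)
  | plusOplus : ∀ (Γ : List (RC × RC)) (lρ lσ : List (ℕ × RC)),
      (∀ x ∈ lσ, x.1 ∈ lρ.map Prod.fst) →
      (∀ (a : ℕ) (ρj σj : RC), (a, ρj) ∈ lρ → (a, σj) ∈ lσ →
        Derives ((RC.ext true lρ, RC.intSum lσ) :: Γ) ρj σj) →
      Derives Γ (.ext true lρ) (.intSum lσ)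
  | unfoldL : ∀ (Γ : List (RC × RC)) (σ τ : RC),
      Derives Γ (RC.unf σ) τ → Derives Γ (.mu σ) τ
  | unfoldR : ∀ (Γ : List (RC × RC)) (ρ σ : RC),
      Derives Γ ρ (RC.unf σ) → Derives Γ ρ (.mu σ)

theorem Step.append {γ δ : Hist} {ρ ρ' : Option RC} {α : Act} (h : Step γ ρ α δ ρ') (η : Hist) :
    Step (γ ++ η) ρ α (δ ++ η) ρ' := by
  induction h with
  | ext γ p l₁ l₂ a σ => exact .ext _ _ _ _ _ _
  | intTau γ l a σ hm hl => exact .intTau _ _ _ _ hm hl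
  | intOut γ a σ => exact .intOut _ _ _
  | rb γ σ' ρ => exact .rb _ _ _
  | mu γ σ α δ ρ _ ih => exact .mu _ _ _ _ _ ih

/-- Forward steps do not depend on the history, so its bottom may be dropped. -/
theorem Step.of_append {γ η δ' : Hist} {ρ ρ' : Option RC} {α : Act}
    (h : Step (γ ++ η) ρ α δ' ρ') (hα : α ≠ .rb) :
    ∃ δ, δ' = δ ++ η ∧ Step γ ρ α δ ρ' := by
  generalize hγ : γ ++ η = γ' at h
  induction h with
  | ext γ' p l₁ l₂ a σ => subst hγ; exact ⟨_ :: γ, rfl, .ext _ _ _ _ _ _⟩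
  | intTau γ' l a σ hm hl => subst hγ; exact ⟨γ, rfl, .intTau _ _ _ _ hm hl⟩
  | intOut γ' a σ => subst hγ; exact ⟨none :: γ, rfl, .intOut _ _ _⟩
  | rb γ' σ' ρ => exact absurd rfl hα
  | mu γ' σ α δ ρ _ ih =>
    obtain ⟨δ₀, hδ, hs⟩ := ih hα hγ
    exact ⟨δ₀, hδ, .mu _ _ _ _ _ hs⟩

theorem Step.rb_eq {γ δ : Hist} {ρ ρ' : Option RC} (h : Step γ ρ .rb δ ρ') : γ = ρ' :: δ := by
  generalize hα : Act.rb = α at h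
  induction h with
  | rb => rfl
  | mu _ _ _ _ _ _ ih => exact ih hα
  | _ => cases hα

/-- The configuration `c` with `η` and `θ` pushed at the bottom of the client's and the
server's history. -/
def Conf.pushBottom (c : Conf) (η θ : Hist) : Conf := ⟨c.cH ++ η, c.c, c.sH ++ θ, c.s⟩

theorem FRed.pushBottom {c d : Conf} (h : FRed c d) (η θ : Hist) :
    FRed (c.pushBottom η θ) (d.pushBottom η θ) := by
  cases h with
  | comm _ _ _ _ _ _ _ _ p a h₁ h₂ =>
    exact .comm _ _ _ _ _ _ _ _ p a (h₁.append η) (h₂.append θ)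
  | tauL _ _ _ _ _ _ h => exact .tauL _ _ _ _ _ _ (h.append η)
  | tauR _ _ _ _ _ _ h => exact .tauR _ _ _ _ _ _ (h.append θ)

theorem FRed.of_pushBottom {c d' : Conf} {η θ : Hist} (h : FRed (c.pushBottom η θ) d') :
    ∃ d, d' = d.pushBottom η θ ∧ FRed c d := by
  obtain ⟨δ, ρ, γ, σ⟩ := c
  dsimp only [Conf.pushBottom] at h
  cases h with
  | comm _ _ _ _ _ _ _ _ p a h₁ h₂ =>
    obtain ⟨δ₁, rfl, k₁⟩ := h₁.of_append (by simp)
    obtain ⟨γ₁, rfl, k₂⟩ := h₂.of_append (by simp)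
    exact ⟨⟨δ₁, _, γ₁, _⟩, rfl, .comm _ _ _ _ _ _ _ _ p a k₁ k₂⟩
  | tauL _ _ _ _ _ _ h =>
    obtain ⟨δ₁, rfl, k⟩ := h.of_append (by simp)
    exact ⟨⟨δ₁, _, γ, _⟩, rfl, .tauL _ _ _ _ _ _ k⟩
  | tauR _ _ _ _ _ _ h =>
    obtain ⟨γ₁, rfl, k⟩ := h.of_append (by simp)
    exact ⟨⟨δ, _, γ₁, _⟩, rfl, .tauR _ _ _ _ _ _ k⟩

theorem Red.pushBottom {c d : Conf} (h : Red c d) (η θ : Hist) :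
    Red (c.pushBottom η θ) (d.pushBottom η θ) := by
  cases h with
  | fwd _ _ h => exact .fwd _ _ (h.pushBottom η θ)
  | rbk _ _ _ _ _ _ _ _ hρ hf h₁ h₂ =>
    refine .rbk _ _ _ _ _ _ _ _ hρ (fun d' hd' => ?_) (h₁.append η) (h₂.append θ)
    obtain ⟨d, -, hd⟩ := FRed.of_pushBottom (c := ⟨_, _, _, _⟩) hd'
    exact hf d hd

/-- A reduction of an extended configuration comes from the original one, unless the latter
is stuck because one of its histories is exhausted. -/
theorem Red.of_pushBottom {c d' : Conf} {η θ : Hist} (h : Red (c.pushBottom η θ) d')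
    (hc : Stuck c → c.c = some .one) : ∃ d, d' = d.pushBottom η θ ∧ Red c d := by
  obtain ⟨δ, ρ, γ, σ⟩ := c
  by_cases hs : Stuck ⟨δ, ρ, γ, σ⟩
  · dsimp only [Conf.pushBottom] at h
    cases h with
    | fwd _ _ h =>
      obtain ⟨d, hd, hr⟩ := FRed.of_pushBottom (c := ⟨δ, ρ, γ, σ⟩) h
      exact ⟨d, hd, .fwd _ _ hr⟩
    | rbk _ _ _ _ _ _ _ _ hρ => exact absurd (hc hs) hρ
  · obtain ⟨d, hd⟩ : ∃ d, Red ⟨δ, ρ, γ, σ⟩ d := by simpa [Stuck] using hs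
    cases h with
    | fwd _ _ h =>
      obtain ⟨d, hd, hr⟩ := FRed.of_pushBottom (c := ⟨δ, ρ, γ, σ⟩) h
      exact ⟨d, hd, .fwd _ _ hr⟩
    | rbk _ _ _ _ _ _ _ _ _ hf h₁ h₂ =>
      cases hd with
      | fwd _ _ hd => exact absurd (hd.pushBottom η θ) (hf _)
      | rbk _ δ₁ _ γ₁ _ ρ₁ _ σ₁ hρ hf' k₁ k₂ =>
        obtain rfl := k₁.rb_eq
        obtain rfl := k₂.rb_eq
        obtain ⟨rfl, rfl⟩ := List.cons.inj h₁.rb_eq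
        obtain ⟨rfl, rfl⟩ := List.cons.inj h₂.rb_eq
        exact ⟨⟨δ₁, _, γ₁, _⟩, rfl, .rbk _ _ _ _ _ _ _ _ hρ hf' k₁ k₂⟩

theorem CompliantCH.append {δ γ : Hist} {ρ σ : Option RC} (h : CompliantCH δ ρ γ σ)
    (η θ : Hist) : CompliantCH (δ ++ η) ρ (γ ++ θ) σ := by
  have key : ∀ c', Reds (Conf.pushBottom ⟨δ, ρ, γ, σ⟩ η θ) c' →
      ∃ c, c' = c.pushBottom η θ ∧ Reds ⟨δ, ρ, γ, σ⟩ c := by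
    intro c' hc'
    induction hc' with
    | refl => exact ⟨_, rfl, .refl⟩
    | tail _ hr ih =>
      obtain ⟨c, rfl, hc⟩ := ih
      obtain ⟨d, rfl, hd⟩ := Red.of_pushBottom hr (h c hc)
      exact ⟨d, rfl, hc.tail hd⟩
  intro c' hc' hs
  obtain ⟨c, rfl, hc⟩ := key c' hc'
  exact h c hc fun d hd => hs _ (hd.pushBottom η θ)

/-- pushing a single element at the bottom of the client's
history, or of the server's history, preserves compliance. -/
theorem compliance_preserved_by_single_extension
    (δ γ : Hist) (ρ σ : Option RC) (h : CompliantCH δ ρ γ σ) :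
    (∀ ρ' : Option RC, CompliantCH (δ ++ [ρ']) ρ γ σ) ∧
    (∀ σ' : Option RC, CompliantCH δ ρ (γ ++ [σ']) σ) := by
  exact ⟨fun ρ' => by simpa using h.append [ρ'] [], fun σ' => by simpa using h.append [] [σ']⟩
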